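/- For every L > 1 there exists a constant C_L > 0 such that for all real x > 0 and λ > 0 with 1/L < λx < L, one has |λ · ∫₀^x E(1/(x−y)) ν′(λ y) dy + 1 + (log λ + 2γ_EM) · ν(xλ)| ≤ C_L · (1 + log⁺ x)/x. -/

import Mathlib

open MeasureTheory Real

/-- The Volterra function `ν(x) = ∫₀^∞ x^s / Γ(s+1) ds` (for `x > 0`; `ν(0) = 0`). -/
noncomputable def volterra (x : ℝ) : ℝ := ∫ s in Set.Ioi (0 : ℝ), x ^ s / Real.Gamma (s + 1)

/-- The derivative of the Volterra function: `ν′(x) = ∫₀^∞ s x^{s−1} / Γ(s+1) ds` for `x > 0`. -/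
noncomputable def volterraDeriv (x : ℝ) : ℝ :=
  ∫ s in Set.Ioi (0 : ℝ), s * x ^ (s - 1) / Real.Gamma (s + 1)

/-- The Euler–Mascheroni constant `γ_EM = −∫₀^∞ e^{−x} log x dx`. -/
noncomputable def eulerGamma : ℝ := -∫ x in Set.Ioi (0 : ℝ), Real.exp (-x) * Real.log x

/-- The exponential integral `E(x) = ∫_x^∞ (e^{−y}/y) dy` for `x > 0`. -/
noncomputable def expInt (x : ℝ) : ℝ := ∫ y in Set.Ioi x, Real.exp (-y) / y

/-- `log⁺ u = max (log u) 0`. -/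
noncomputable def logPlus (u : ℝ) : ℝ := max (Real.log u) 0

open Set Filter Topology

theorem inv_Gamma_le {B s : ℝ} (hB : 0 < B) (hs : 0 < s) :
    (Real.Gamma s)⁻¹ ≤ s * (Real.exp B * B ^ (-s)) := by
  have hG : B ^ s * Real.exp (-B) ≤ Real.Gamma (s + 1) := by
    have hint := Real.GammaIntegral_convergent (s := s + 1) (by linarith)
    rw [add_sub_cancel_right] at hint
    rw [Real.Gamma_eq_integral (by linarith), add_sub_cancel_right, ← integral_exp_neg_Ioi,
      ← integral_const_mul]
    calc ∫ t in Ioi B, B ^ s * Real.exp (-t)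
        ≤ ∫ t in Ioi B, Real.exp (-t) * t ^ s := by
          refine setIntegral_mono_on ((integrableOn_exp_neg_Ioi B).const_mul _)
            (hint.mono_set (Ioi_subset_Ioi hB.le)) measurableSet_Ioi fun t ht => ?_
          rw [mul_comm]
          have : B ^ s ≤ t ^ s := Real.rpow_le_rpow hB.le (le_of_lt ht) hs.le
          gcongr
      _ ≤ ∫ t in Ioi 0, Real.exp (-t) * t ^ s := by
          refine setIntegral_mono_set hint ?_ (Ioi_subset_Ioi hB.le).eventuallyLE
          filter_upwards [ae_restrict_mem measurableSet_Ioi] with t ht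
          have : (0 : ℝ) < t := ht
          positivity
  rw [Real.Gamma_add_one hs.ne'] at hG
  have hΓ := Real.Gamma_pos_of_pos hs
  have hBs : 0 < B ^ s := Real.rpow_pos_of_pos hB s
  rw [Real.rpow_neg hB.le, inv_le_iff_one_le_mul₀ hΓ]
  rw [Real.exp_neg] at hG
  have he := Real.exp_pos B
  calc (1 : ℝ) = (B ^ s * (Real.exp B)⁻¹) * (Real.exp B * (B ^ s)⁻¹) := by field_simp
    _ ≤ (s * Real.Gamma s) * (Real.exp B * (B ^ s)⁻¹) := by gcongr
    _ = _ := by ring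

theorem measurable_inv_Gamma : Measurable fun s : ℝ => (Real.Gamma s)⁻¹ := by
  have h : Continuous fun s : ℝ => ((Complex.Gamma s)⁻¹).re :=
    Complex.continuous_re.comp
      (Complex.differentiable_one_div_Gamma.continuous.comp Complex.continuous_ofReal)
  convert h.measurable using 2 with s
  rw [Complex.Gamma_ofReal, ← Complex.ofReal_inv, Complex.ofReal_re]

theorem integrableOn_rpow_mul_inv_Gamma {X : ℝ} (hX : 0 < X) :
    IntegrableOn (fun s => X ^ (s - 1) * (Real.Gamma s)⁻¹) (Ioi 0) := by
  set B := X * Real.exp 1 with hBdef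
  have hB : 0 < B := by positivity
  have hint := (Real.GammaIntegral_convergent (s := 2) (by norm_num)).const_mul
    (X⁻¹ * Real.exp B)
  refine Integrable.mono' hint ?_ ?_
  · exact (((measurable_const.pow (measurable_id.sub_const 1))).mul
      measurable_inv_Gamma).aestronglyMeasurable
  · filter_upwards [ae_restrict_mem measurableSet_Ioi] with s hs
    have hs : 0 < s := hs
    have hΓ := Real.Gamma_pos_of_pos hs
    have hXs : 0 < X ^ s := Real.rpow_pos_of_pos hX s
    rw [Real.norm_of_nonneg (by positivity)]
    calc X ^ (s - 1) * (Real.Gamma s)⁻¹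
        ≤ X ^ (s - 1) * (s * (Real.exp B * B ^ (-s))) := by
          gcongr
          exact inv_Gamma_le hB hs
      _ = _ := by
          rw [hBdef, Real.mul_rpow hX.le (Real.exp_pos 1).le, Real.rpow_neg hX.le,
            ← Real.exp_mul, Real.rpow_sub_one hX.ne']
          norm_num
          field_simp

theorem integral_rpow_mul_rpow_Ioo {X a s : ℝ} (hX : 0 < X) (ha : 0 < a) (hs : 0 < s) :
    ∫ w in Ioo 0 X, (X - w) ^ (a - 1) * w ^ (s - 1) =
      X ^ (s + a - 1) * (Real.Gamma a * Real.Gamma s / Real.Gamma (s + a)) := by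
  have h := Complex.betaIntegral_scaled s a hX
  rw [Complex.betaIntegral_eq_Gamma_mul_div _ _ (by simpa) (by simpa),
    intervalIntegral.integral_of_le hX.le, integral_Ioc_eq_integral_Ioo] at h
  have h2 : ∫ w in Ioo 0 X, (w : ℂ) ^ ((s : ℂ) - 1) * ((X : ℂ) - w) ^ ((a : ℂ) - 1) =
      ∫ w in Ioo 0 X, (((X - w) ^ (a - 1) * w ^ (s - 1) : ℝ) : ℂ) := by
    refine setIntegral_congr_fun measurableSet_Ioo fun w hw => ?_
    rw [Complex.ofReal_mul, Complex.ofReal_cpow (sub_pos.2 hw.2).le,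
      Complex.ofReal_cpow hw.1.le]
    push_cast
    ring
  rw [h2, integral_complex_ofReal] at h
  have h3 : (X : ℂ) ^ ((s : ℂ) + a - 1) *
      (Complex.Gamma s * Complex.Gamma a / Complex.Gamma (s + a)) =
      ((X ^ (s + a - 1) * (Real.Gamma a * Real.Gamma s / Real.Gamma (s + a)) : ℝ) : ℂ) := by
    push_cast
    rw [Complex.ofReal_cpow hX.le, ← Complex.Gamma_ofReal, ← Complex.Gamma_ofReal,
      ← Complex.Gamma_ofReal]
    push_cast
    ring
  rw [h3] at h
  exact_mod_cast h

theorem integrableOn_rpow_mul_rpow_Ioo {X a s : ℝ} (hX : 0 < X) (ha : 0 < a) (hs : 0 < s) :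
    IntegrableOn (fun w => (X - w) ^ (a - 1) * w ^ (s - 1)) (Ioo 0 X) := by
  refine Integrable.of_integral_ne_zero ?_
  rw [integral_rpow_mul_rpow_Ioo hX ha hs]
  have h1 := Real.Gamma_pos_of_pos ha
  have h2 := Real.Gamma_pos_of_pos hs
  have h3 := Real.Gamma_pos_of_pos (add_pos hs ha)
  positivity

theorem volterraDeriv_eq {w : ℝ} :
    volterraDeriv w = ∫ s in Ioi (0 : ℝ), w ^ (s - 1) * (Real.Gamma s)⁻¹ := by
  refine setIntegral_congr_fun measurableSet_Ioi fun s hs => ?_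
  have hs : 0 < s := hs
  have h2 := Real.Gamma_pos_of_pos hs
  rw [Real.Gamma_add_one hs.ne']
  field_simp

theorem setIntegral_comp_add_right_Ioi (f : ℝ → ℝ) (a : ℝ) :
    ∫ s in Ioi (0 : ℝ), f (s + a) = ∫ s in Ioi a, f s := by
  have h := (measurePreserving_add_right volume a).setIntegral_preimage_emb
    (measurableEmbedding_addRight a) f (Ioi a)
  simpa using h

theorem integrableOn_comp_add_right_Ioi {f : ℝ → ℝ} {a : ℝ} (hf : IntegrableOn f (Ioi a)) :
    IntegrableOn (fun s => f (s + a)) (Ioi 0) := by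
  have h := ((measurePreserving_add_right volume a).integrableOn_comp_preimage
    (measurableEmbedding_addRight a)).2 hf
  simpa [Function.comp_def] using h

theorem volterra_eq {w : ℝ} :
    volterra w = ∫ s in Ioi (1 : ℝ), w ^ (s - 1) * (Real.Gamma s)⁻¹ := by
  rw [← setIntegral_comp_add_right_Ioi]
  simp [volterra, div_eq_mul_inv]

theorem integrableOn_shift_rpow_mul_inv_Gamma {X a : ℝ} (hX : 0 < X) (ha : 0 < a) :
    IntegrableOn (fun s => X ^ (s + a - 1) * (Real.Gamma (s + a))⁻¹) (Ioi 0) :=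
  integrableOn_comp_add_right_Ioi ((integrableOn_rpow_mul_inv_Gamma hX).mono_set
    (Ioi_subset_Ioi ha.le))

theorem integrable_prod_volterra_kernel {X a : ℝ} (hX : 0 < X) (ha : 0 < a) :
    Integrable (fun p : ℝ × ℝ => (X - p.1) ^ (a - 1) * (p.1 ^ (p.2 - 1) * (Real.Gamma p.2)⁻¹))
      ((volume.restrict (Ioo 0 X)).prod (volume.restrict (Ioi 0))) := by
  have hm : Measurable fun p : ℝ × ℝ =>
      (X - p.1) ^ (a - 1) * (p.1 ^ (p.2 - 1) * (Real.Gamma p.2)⁻¹) :=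
    ((measurable_const.sub measurable_fst).pow_const _).mul
      ((measurable_fst.pow (measurable_snd.sub_const 1)).mul
        (measurable_inv_Gamma.comp measurable_snd))
  rw [integrable_prod_iff' hm.aestronglyMeasurable]
  refine ⟨?_, ?_⟩
  · filter_upwards [ae_restrict_mem measurableSet_Ioi] with s hs
    simp only [← mul_assoc]
    exact (integrableOn_rpow_mul_rpow_Ioo hX ha hs).mul_const _
  · refine ((integrableOn_shift_rpow_mul_inv_Gamma hX ha).const_mul (Real.Gamma a)).congr ?_
    filter_upwards [ae_restrict_mem measurableSet_Ioi] with s hs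
    have hs : 0 < s := hs
    have hΓ := Real.Gamma_pos_of_pos hs
    have : ∫ w in Ioo 0 X, ‖(X - w) ^ (a - 1) * (w ^ (s - 1) * (Real.Gamma s)⁻¹)‖ =
        ∫ w in Ioo 0 X, (X - w) ^ (a - 1) * w ^ (s - 1) * (Real.Gamma s)⁻¹ := by
      refine setIntegral_congr_fun measurableSet_Ioo fun w hw => ?_
      have h1 : 0 < X - w := sub_pos.2 hw.2
      have h2 := hw.1
      rw [Real.norm_of_nonneg (by positivity)]
      ring
    rw [this, integral_mul_const, integral_rpow_mul_rpow_Ioo hX ha hs]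
    field_simp

theorem integrableOn_rpow_mul_volterraDeriv {X a : ℝ} (hX : 0 < X) (ha : 0 < a) :
    IntegrableOn (fun w => (X - w) ^ (a - 1) * volterraDeriv w) (Ioo 0 X) := by
  have h := (integrable_prod_volterra_kernel hX ha).integral_prod_left
  simp only [integral_const_mul, ← volterraDeriv_eq] at h
  exact h

theorem integral_rpow_mul_volterraDeriv {X a : ℝ} (hX : 0 < X) (ha : 0 < a) :
    ∫ w in Ioo 0 X, (X - w) ^ (a - 1) * volterraDeriv w =
      Real.Gamma a * ∫ s in Ioi a, X ^ (s - 1) * (Real.Gamma s)⁻¹ := by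
  have h := integral_integral_swap (f := fun w s =>
    (X - w) ^ (a - 1) * (w ^ (s - 1) * (Real.Gamma s)⁻¹)) (integrable_prod_volterra_kernel hX ha)
  simp only [integral_const_mul, ← volterraDeriv_eq] at h
  rw [h, ← setIntegral_comp_add_right_Ioi _ a, ← integral_const_mul]
  refine setIntegral_congr_fun measurableSet_Ioi fun s hs => ?_
  have hs : 0 < s := hs
  have hΓ := Real.Gamma_pos_of_pos hs
  simp only [← mul_assoc]
  rw [integral_mul_const, integral_rpow_mul_rpow_Ioo hX ha hs]
  field_simp

theorem eulerGamma_eq : eulerGamma = Real.eulerMascheroniConstant := by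
  have h1 := Complex.hasDerivAt_GammaIntegral (s := 1) (by simp)
  have h2 : HasDerivAt Complex.GammaIntegral (-(Real.eulerMascheroniConstant : ℂ)) 1 := by
    refine Complex.hasDerivAt_Gamma_one.congr_of_eventuallyEq ?_
    have : IsOpen {s : ℂ | 0 < s.re} := isOpen_lt continuous_const Complex.continuous_re
    filter_upwards [this.mem_nhds (show (0 : ℝ) < (1 : ℂ).re by simp)] with s hs
    exact (Complex.Gamma_eq_integral hs).symm
  have h3 := h1.unique h2
  have h4 : ∫ t in Ioi (0 : ℝ), (t : ℂ) ^ ((1 : ℂ) - 1) * (Real.log t * Real.exp (-t)) =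
      ((∫ t in Ioi (0 : ℝ), Real.exp (-t) * Real.log t : ℝ) : ℂ) := by
    rw [← integral_complex_ofReal]
    refine setIntegral_congr_fun measurableSet_Ioi fun t _ => ?_
    simp [mul_comm]
  rw [h4] at h3
  have h5 : ∫ t in Ioi (0 : ℝ), Real.exp (-t) * Real.log t = -Real.eulerMascheroniConstant := by
    exact_mod_cast h3
  rw [eulerGamma, h5, neg_neg]

theorem hasDerivAt_Gamma_one_eulerGamma : HasDerivAt Real.Gamma (-eulerGamma) 1 := by
  rw [eulerGamma_eq]
  exact Real.hasDerivAt_Gamma_one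

theorem volterraDeriv_nonneg {w : ℝ} (hw : 0 ≤ w) : 0 ≤ volterraDeriv w := by
  rw [volterraDeriv_eq]
  refine setIntegral_nonneg measurableSet_Ioi fun s hs => ?_
  have := Real.Gamma_pos_of_pos hs
  positivity

theorem integrableOn_volterraDeriv {X : ℝ} (hX : 0 < X) :
    IntegrableOn volterraDeriv (Ioo 0 X) := by
  simpa using integrableOn_rpow_mul_volterraDeriv hX one_pos

theorem integral_volterraDeriv {X : ℝ} (hX : 0 < X) :
    ∫ w in Ioo 0 X, volterraDeriv w = volterra X := by
  rw [volterra_eq]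
  simpa using integral_rpow_mul_volterraDeriv hX one_pos

theorem hasDerivAt_integral_Ioi_rpow_mul_inv_Gamma {X : ℝ} (hX : 0 < X) :
    HasDerivAt (fun a => ∫ s in Ioi a, X ^ (s - 1) * (Real.Gamma s)⁻¹) (-1) 1 := by
  set k := fun s : ℝ => X ^ (s - 1) * (Real.Gamma s)⁻¹ with hk
  have hkint := integrableOn_rpow_mul_inv_Gamma hX
  have hm : Measurable k := ((measurable_const.pow (measurable_id.sub_const 1))).mul
    measurable_inv_Gamma
  have hcont : ContinuousAt k 1 := by
    refine ContinuousAt.mul ?_ (hasDerivAt_Gamma_one_eulerGamma.continuousAt.inv₀ (by simp))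
    exact (Real.continuousAt_const_rpow hX.ne').comp (by fun_prop)
  have h1 := intervalIntegral.integral_hasDerivAt_right (a := 1) (b := 1) (f := k)
    (by simp) (hm.stronglyMeasurable.stronglyMeasurableAtFilter) hcont
  have h2 := h1.const_sub (∫ s in Ioi 1, k s)
  have hk1 : k 1 = 1 := by simp [hk]
  rw [hk1] at h2
  refine h2.congr_of_eventuallyEq ?_
  filter_upwards [lt_mem_nhds (zero_lt_one (α := ℝ))] with a ha
  have := intervalIntegral.integral_interval_add_Ioi
    (hkint.mono_set (Ioi_subset_Ioi zero_le_one)) (hkint.mono_set (Ioi_subset_Ioi ha.le))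
  change ∫ s in Ioi a, k s = _
  rw [← this]
  ring

theorem abs_rpow_mul_log_le {u b : ℝ} (hu : 0 < u) (hb : b ∈ Icc (-(1 / 2) : ℝ) (1 / 2)) :
    |u ^ b * Real.log u| ≤
      4 * u ^ (-(3 / 4) : ℝ) + u ^ (1 / 2 : ℝ) + 4 * u ^ (1 / 4 : ℝ) + u ^ (3 / 2 : ℝ) := by
  have hlog : |Real.log u| ≤ u + 4 * u ^ (-(1 / 4) : ℝ) := by
    have h1 := Real.log_le_sub_one_of_pos hu
    have h2 := Real.log_le_sub_one_of_pos (Real.rpow_pos_of_pos hu (-(1 / 4)))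
    rw [Real.log_rpow hu] at h2
    have h3 := Real.rpow_pos_of_pos hu (-(1 / 4))
    rw [abs_le]
    constructor <;> linarith
  have hpow : u ^ b ≤ u ^ (-(1 / 2) : ℝ) + u ^ (1 / 2 : ℝ) := by
    have h3 := Real.rpow_pos_of_pos hu (-(1 / 2))
    have h4 := Real.rpow_pos_of_pos hu (1 / 2)
    rcases le_total u 1 with h | h
    · have := Real.rpow_le_rpow_of_exponent_ge hu h hb.1
      linarith
    · have := Real.rpow_le_rpow_of_exponent_le h hb.2
      linarith
  rw [abs_mul, abs_of_pos (Real.rpow_pos_of_pos hu b)]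
  calc u ^ b * |Real.log u|
      ≤ (u ^ (-(1 / 2) : ℝ) + u ^ (1 / 2 : ℝ)) * (u ^ (1 : ℝ) + 4 * u ^ (-(1 / 4) : ℝ)) := by
        rw [Real.rpow_one]
        gcongr
    _ = _ := by
        have e1 : u ^ (-(1 / 2) : ℝ) * u ^ (1 : ℝ) = u ^ (1 / 2 : ℝ) := by
          rw [← Real.rpow_add hu]; norm_num
        have e2 : u ^ (-(1 / 2) : ℝ) * u ^ (-(1 / 4) : ℝ) = u ^ (-(3 / 4) : ℝ) := by
          rw [← Real.rpow_add hu]; norm_num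
        have e3 : u ^ (1 / 2 : ℝ) * u ^ (1 : ℝ) = u ^ (3 / 2 : ℝ) := by
          rw [← Real.rpow_add hu]; norm_num
        have e4 : u ^ (1 / 2 : ℝ) * u ^ (-(1 / 4) : ℝ) = u ^ (1 / 4 : ℝ) := by
          rw [← Real.rpow_add hu]; norm_num
        linear_combination e1 + 4 * e2 + e3 + 4 * e4

theorem log_convolution_volterraDeriv {X : ℝ} (hX : 0 < X) :
    IntegrableOn (fun w => Real.log (X - w) * volterraDeriv w) (Ioo 0 X) ∧
      ∫ w in Ioo 0 X, Real.log (X - w) * volterraDeriv w = -1 - eulerGamma * volterra X := by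
  have hI := fun a (ha : 0 < a) => integrableOn_rpow_mul_volterraDeriv hX (a := a) ha
  have key := hasDerivAt_integral_of_dominated_loc_of_deriv_le
    (μ := volume.restrict (Ioo 0 X)) (x₀ := (1 : ℝ)) (s := Icc (1 / 2) (3 / 2))
    (F := fun a w => (X - w) ^ (a - 1) * volterraDeriv w)
    (F' := fun a w => (X - w) ^ (a - 1) * Real.log (X - w) * volterraDeriv w)
    (bound := fun w => (4 * (X - w) ^ (-(3 / 4) : ℝ) + (X - w) ^ (1 / 2 : ℝ)
      + 4 * (X - w) ^ (1 / 4 : ℝ) + (X - w) ^ (3 / 2 : ℝ)) * volterraDeriv w)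
    (Icc_mem_nhds (by norm_num) (by norm_num)) ?_ (hI 1 one_pos) ?_ ?_ ?_ ?_
  · have hder := (hasDerivAt_Gamma_one_eulerGamma.mul
      (hasDerivAt_integral_Ioi_rpow_mul_inv_Gamma hX))
    have hG := hder.congr_of_eventuallyEq
      (f₁ := fun a => ∫ w in Ioo 0 X, (X - w) ^ (a - 1) * volterraDeriv w) (by
        filter_upwards [lt_mem_nhds (zero_lt_one (α := ℝ))] with a ha
        exact integral_rpow_mul_volterraDeriv hX ha)
    have hu := key.2.unique hG
    rw [← volterra_eq] at hu
    simp only [sub_self, Real.rpow_zero, one_mul, Real.Gamma_one] at hu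
    refine ⟨by simpa [IntegrableOn] using key.1, ?_⟩
    rw [hu]
    ring
  · filter_upwards [lt_mem_nhds (zero_lt_one (α := ℝ))] with a ha
    exact (hI a ha).aestronglyMeasurable
  · have : Measurable fun w => (X - w) ^ ((1 : ℝ) - 1) * Real.log (X - w) := by fun_prop
    exact this.aestronglyMeasurable.mul (integrableOn_volterraDeriv hX).aestronglyMeasurable
  · filter_upwards [ae_restrict_mem measurableSet_Ioo] with w hw a ha
    have h0 := volterraDeriv_nonneg hw.1.le
    rw [norm_mul, Real.norm_of_nonneg h0, Real.norm_eq_abs]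
    gcongr
    refine abs_rpow_mul_log_le (sub_pos.2 hw.2) ⟨?_, ?_⟩ <;> linarith [ha.1, ha.2]
  · have h1 := (hI (1 / 4) (by norm_num)).const_mul 4
    have h2 := hI (3 / 2) (by norm_num)
    have h3 := (hI (5 / 4) (by norm_num)).const_mul 4
    have h4 := hI (5 / 2) (by norm_num)
    refine (((h1.add h2).add h3).add h4).congr (.of_forall fun w => ?_)
    simp only [Pi.add_apply]
    norm_num
    ring
  · filter_upwards [ae_restrict_mem measurableSet_Ioo] with w hw a ha
    have h := ((Real.hasStrictDerivAt_const_rpow (sub_pos.2 hw.2) (a - 1)).hasDerivAt.comp a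
      ((hasDerivAt_id a).sub_const 1)).mul_const (volterraDeriv w)
    simpa [Function.comp_def] using h

theorem integrableOn_exp_neg_mul_log :
    IntegrableOn (fun y => Real.exp (-y) * Real.log y) (Ioi 0) := by
  have h1 := Real.GammaIntegral_convergent (s := 2) (by norm_num)
  have h2 := (Real.GammaIntegral_convergent (s := 1 / 2) (by norm_num)).const_mul 2
  refine Integrable.mono' (h1.add h2) ?_ ?_
  · exact (by fun_prop : Measurable fun y => Real.exp (-y) * Real.log y).aestronglyMeasurable
  · filter_upwards [ae_restrict_mem measurableSet_Ioi] with y hy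
    have hy : 0 < y := hy
    have hlog : |Real.log y| ≤ y + 2 * y ^ (-(1 / 2) : ℝ) := by
      have h1 := Real.log_le_sub_one_of_pos hy
      have h2 := Real.log_le_sub_one_of_pos (Real.rpow_pos_of_pos hy (-(1 / 2)))
      rw [Real.log_rpow hy] at h2
      have h3 := Real.rpow_pos_of_pos hy (-(1 / 2))
      rw [abs_le]
      constructor <;> linarith
    rw [norm_mul, Real.norm_of_nonneg (Real.exp_pos _).le, Real.norm_eq_abs]
    calc Real.exp (-y) * |Real.log y| ≤ Real.exp (-y) * (y + 2 * y ^ (-(1 / 2) : ℝ)) := by gcongr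
      _ = _ := by
        simp only [Pi.add_apply]
        norm_num
        ring

theorem integrableOn_exp_neg_div {a : ℝ} (ha : 0 < a) :
    IntegrableOn (fun y => Real.exp (-y) / y) (Ioi a) := by
  refine Integrable.mono' ((integrableOn_exp_neg_Ioi a).mul_const a⁻¹) ?_ ?_
  · exact (by fun_prop : Measurable fun y => Real.exp (-y) / y).aestronglyMeasurable
  · filter_upwards [ae_restrict_mem measurableSet_Ioi] with y hy
    have hy : a < y := hy
    have hy0 : 0 < y := ha.trans hy
    rw [Real.norm_of_nonneg (by positivity), div_eq_mul_inv]
    gcongr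

theorem expInt_eq {z : ℝ} (hz : 0 < z) :
    expInt z = -(Real.exp (-z) * Real.log z) + ∫ y in Ioi z, Real.exp (-y) * Real.log y := by
  have hi := integrableOn_exp_neg_mul_log.mono_set (Ioi_subset_Ioi hz.le)
  have hd : ∀ y ∈ Ici z, HasDerivAt (fun y => Real.exp (-y) * Real.log y)
      (Real.exp (-y) / y - Real.exp (-y) * Real.log y) y := by
    intro y hy
    have hy0 : y ≠ 0 := (hz.trans_le hy).ne'
    have := ((hasDerivAt_neg y).exp).mul (Real.hasDerivAt_log hy0)
    convert! this using 1
    ring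
  have ht : Tendsto (fun y => Real.exp (-y) * Real.log y) atTop (𝓝 0) := by
    refine squeeze_zero' (g := fun y => y ^ (1 : ℝ) * Real.exp (-1 * y)) ?_ ?_
      (tendsto_rpow_mul_exp_neg_mul_atTop_nhds_zero 1 1 one_pos)
    · filter_upwards [eventually_ge_atTop 1] with y hy
      have := Real.log_nonneg hy
      positivity
    · filter_upwards [eventually_ge_atTop 1] with y hy
      have := Real.log_le_self (zero_le_one.trans hy)
      rw [Real.rpow_one, mul_comm, neg_one_mul]
      gcongr
  have h := integral_Ioi_of_hasDerivAt_of_tendsto' hd ((integrableOn_exp_neg_div hz).sub hi) ht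
  rw [integral_sub (integrableOn_exp_neg_div hz) hi] at h
  rw [expInt]
  linarith

theorem tendsto_expInt_add_log :
    Tendsto (fun z => expInt z + Real.log z) (𝓝[>] 0) (𝓝 (-eulerGamma)) := by
  have h1 : Tendsto (fun z => ∫ y in Ioi z, Real.exp (-y) * Real.log y) (𝓝[>] 0)
      (𝓝 (-eulerGamma)) := by
    rw [eulerGamma, neg_neg]
    have := integrableOn_exp_neg_mul_log.continuousOn_Ici_primitive_Ioi 0
      self_mem_Ici
    exact this.mono_left (nhdsWithin_mono _ Ioi_subset_Ici_self)
  have h2 : Tendsto (fun z => (1 - Real.exp (-z)) * Real.log z) (𝓝[>] 0) (𝓝 0) := by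
    have h3 := (Real.continuous_mul_log.tendsto 0).abs
    simp only [zero_mul, abs_zero] at h3
    refine squeeze_zero_norm' ?_ (h3.mono_left nhdsWithin_le_nhds)
    filter_upwards [self_mem_nhdsWithin] with z hz
    have hz : 0 < z := hz
    have h4 := Real.add_one_le_exp (-z)
    have h5 : Real.exp (-z) ≤ 1 := Real.exp_le_one_iff.2 (by linarith)
    rw [norm_mul, abs_mul, Real.norm_eq_abs, Real.norm_eq_abs, abs_of_pos hz,
      abs_of_nonneg (by linarith)]
    gcongr
    linarith
  have h := h2.add h1
  rw [zero_add] at h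
  refine h.congr' ?_
  filter_upwards [self_mem_nhdsWithin] with z hz
  rw [expInt_eq hz]
  ring

theorem expInt_add_log_sub {a b : ℝ} (ha : 0 < a) (hab : a ≤ b) :
    (expInt b + Real.log b) - (expInt a + Real.log a) =
      ∫ y in a..b, (1 - Real.exp (-y)) * y⁻¹ := by
  have hb := ha.trans_le hab
  have h1 := intervalIntegral.integral_interval_add_Ioi (integrableOn_exp_neg_div ha)
    (integrableOn_exp_neg_div hb)
  have h2 := integral_inv_of_pos ha hb
  rw [Real.log_div hb.ne' ha.ne'] at h2
  have h0 : ∀ y ∈ uIcc a b, y ≠ 0 := fun y hy => by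
    rw [uIcc_of_le hab] at hy
    exact (ha.trans_le hy.1).ne'
  have e1 : IntervalIntegrable (fun y : ℝ => y⁻¹) volume a b :=
    (continuousOn_inv₀.mono h0).intervalIntegrable
  have e2 : IntervalIntegrable (fun y : ℝ => Real.exp (-y) / y) volume a b :=
    ((Real.continuous_exp.comp continuous_neg).continuousOn.div continuousOn_id
      h0).intervalIntegrable
  have h3 := intervalIntegral.integral_sub e1 e2
  rw [h2] at h3
  have h4 : ∫ y in a..b, (1 - Real.exp (-y)) * y⁻¹ = ∫ y in a..b, y⁻¹ - Real.exp (-y) / y := by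
    congr 1 with y
    ring
  rw [h4, h3, expInt, expInt, ← h1]
  ring

theorem intervalIntegrable_one_sub_exp_neg_mul_inv {a b : ℝ} (ha : 0 < a) (hab : a ≤ b) :
    IntervalIntegrable (fun y => (1 - Real.exp (-y)) * y⁻¹) volume a b := by
  refine ContinuousOn.intervalIntegrable ?_
  refine ContinuousOn.mul (by fun_prop) (continuousOn_inv₀.mono fun y hy => ?_)
  rw [uIcc_of_le hab] at hy
  exact (ha.trans_le hy.1).ne'

/-- The entire exponential integral `∫₀^z (1 - e^{-y}) / y dy`, written through `expInt`. -/
noncomputable def entireExpInt (z : ℝ) : ℝ := expInt z + Real.log z + eulerGamma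

theorem monotoneOn_entireExpInt : MonotoneOn entireExpInt (Ioi 0) := by
  intro a ha b _ hab
  have ha : 0 < a := ha
  have h := expInt_add_log_sub ha hab
  have : 0 ≤ ∫ y in a..b, (1 - Real.exp (-y)) * y⁻¹ := by
    refine intervalIntegral.integral_nonneg hab fun y hy => ?_
    have hy0 : 0 < y := ha.trans_le hy.1
    have : Real.exp (-y) ≤ 1 := Real.exp_le_one_iff.2 (by linarith)
    exact mul_nonneg (by linarith) (by positivity)
  simp only [entireExpInt]
  linarith

theorem tendsto_entireExpInt : Tendsto entireExpInt (𝓝[>] 0) (𝓝 0) := by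
  have h := tendsto_expInt_add_log.add_const eulerGamma
  rw [neg_add_cancel] at h
  exact h

theorem entireExpInt_nonneg {z : ℝ} (hz : 0 < z) : 0 ≤ entireExpInt z := by
  refine le_of_tendsto tendsto_entireExpInt ?_
  filter_upwards [Ioo_mem_nhdsGT hz] with a ha
  exact monotoneOn_entireExpInt ha.1 hz ha.2.le

theorem entireExpInt_le_self {z : ℝ} (hz : 0 < z) : entireExpInt z ≤ z := by
  have ht := tendsto_entireExpInt.add_const z
  rw [zero_add] at ht
  refine ge_of_tendsto ht ?_
  filter_upwards [Ioo_mem_nhdsGT hz] with a ha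
  have h := expInt_add_log_sub ha.1 ha.2.le
  have h2 : ∫ y in a..z, (1 - Real.exp (-y)) * y⁻¹ ≤ ∫ y in a..z, (1 : ℝ) := by
    refine intervalIntegral.integral_mono_on ha.2.le
      (intervalIntegrable_one_sub_exp_neg_mul_inv ha.1 ha.2.le) (by simp) fun y hy => ?_
    have hy0 : 0 < y := ha.1.trans_le hy.1
    rw [← div_eq_mul_inv, div_le_one hy0]
    linarith [Real.add_one_le_exp (-y)]
  rw [intervalIntegral.integral_const, smul_eq_mul, mul_one] at h2
  simp only [entireExpInt]
  linarith [ha.1]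

theorem entireExpInt_le_two_mul_rpow {z : ℝ} (hz : 0 < z) :
    entireExpInt z ≤ 2 * z ^ (1 / 2 : ℝ) := by
  have ht := tendsto_entireExpInt.add_const (2 * z ^ (1 / 2 : ℝ))
  rw [zero_add] at ht
  refine ge_of_tendsto ht ?_
  filter_upwards [Ioo_mem_nhdsGT hz] with a ha
  have h := expInt_add_log_sub ha.1 ha.2.le
  have h2 : ∫ y in a..z, (1 - Real.exp (-y)) * y⁻¹ ≤ ∫ y in a..z, y ^ (-(1 / 2) : ℝ) := by
    refine intervalIntegral.integral_mono_on ha.2.le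
      (intervalIntegrable_one_sub_exp_neg_mul_inv ha.1 ha.2.le)
      (intervalIntegral.intervalIntegrable_rpow' (by norm_num)) fun y hy => ?_
    have hy0 : 0 < y := ha.1.trans_le hy.1
    have h3 : 1 - Real.exp (-y) ≤ y ^ (1 / 2 : ℝ) := by
      rcases le_total y 1 with h | h
      · have := Real.rpow_le_rpow_of_exponent_ge hy0 h (show (1 / 2 : ℝ) ≤ 1 by norm_num)
        rw [Real.rpow_one] at this
        linarith [Real.add_one_le_exp (-y)]
      · have := Real.one_le_rpow h (show (0 : ℝ) ≤ 1 / 2 by norm_num)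
        linarith [Real.exp_pos (-y)]
    calc (1 - Real.exp (-y)) * y⁻¹ ≤ y ^ (1 / 2 : ℝ) * y ^ (-1 : ℝ) := by
          rw [Real.rpow_neg_one]
          gcongr
      _ = _ := by rw [← Real.rpow_add hy0]; norm_num
  rw [integral_rpow (Or.inl (by norm_num))] at h2
  norm_num at h2
  have h4 := Real.rpow_pos_of_pos ha.1 (1 / 2)
  simp only [entireExpInt]
  norm_num at h4 ⊢
  linarith

theorem aestronglyMeasurable_entireExpInt_div_sub {X lam : ℝ} (hlam : 0 < lam) :
    AEStronglyMeasurable (fun w => entireExpInt (lam / (X - w)))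
      (volume.restrict (Ioo 0 X)) := by
  refine (aemeasurable_restrict_of_monotoneOn measurableSet_Ioo
    fun a ha b hb hab => ?_).aestronglyMeasurable
  have h1 := sub_pos.2 ha.2
  have h2 := sub_pos.2 hb.2
  refine monotoneOn_entireExpInt (div_pos hlam h1) (div_pos hlam h2) ?_
  gcongr

theorem entireExpInt_div_le {lam u : ℝ} (hlam : 0 < lam) (hu : 0 < u) :
    entireExpInt (lam / u) ≤ 2 * lam ^ (1 / 2 : ℝ) * u ^ (-(1 / 2) : ℝ) := by
  refine (entireExpInt_le_two_mul_rpow (div_pos hlam hu)).trans_eq ?_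
  rw [Real.div_rpow hlam.le hu.le, Real.rpow_neg hu.le]
  ring

theorem intervalIntegrable_entireExpInt_div {lam M : ℝ} (hlam : 0 < lam) (hM : 0 < M) :
    IntervalIntegrable (fun u => entireExpInt (lam / u)) volume 0 M := by
  have hi : IntervalIntegrable (fun u : ℝ => 2 * lam ^ (1 / 2 : ℝ) * u ^ (-(1 / 2) : ℝ))
      volume 0 M :=
    (intervalIntegral.intervalIntegrable_rpow' (by norm_num)).const_mul _
  rw [intervalIntegrable_iff_integrableOn_Ioc_of_le hM.le] at hi ⊢
  refine Integrable.mono' hi ?_ ?_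
  · refine (aemeasurable_restrict_of_antitoneOn measurableSet_Ioc
      fun a ha b hb hab => ?_).aestronglyMeasurable
    have h1 : 0 < a := ha.1
    have h2 : 0 < b := hb.1
    refine monotoneOn_entireExpInt (div_pos hlam h2) (div_pos hlam h1) ?_
    gcongr
  · filter_upwards [ae_restrict_mem measurableSet_Ioc] with u hu
    rw [Real.norm_of_nonneg (entireExpInt_nonneg (div_pos hlam hu.1))]
    exact entireExpInt_div_le hlam hu.1

theorem integral_entireExpInt_div_le {lam X : ℝ} (hlam : 0 < lam) (hX : 0 < X) :
    ∫ u in (0 : ℝ)..X, entireExpInt (lam / u) ≤ lam * (4 + logPlus (X / lam)) := by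
  set M := max X lam with hMdef
  have hM : 0 < M := lt_max_of_lt_left hX
  have hlM : lam ≤ M := le_max_right _ _
  have hi := intervalIntegrable_entireExpInt_div hlam hM
  have hi1 := intervalIntegrable_entireExpInt_div hlam hlam
  have hi2 : IntervalIntegrable (fun u => entireExpInt (lam / u)) volume lam M := hi1.symm.trans hi
  have h1 : ∫ u in (0 : ℝ)..X, entireExpInt (lam / u) ≤
      ∫ u in (0 : ℝ)..M, entireExpInt (lam / u) := by
    refine intervalIntegral.integral_mono_interval le_rfl hX.le (le_max_left _ _) ?_ hi
    filter_upwards [ae_restrict_mem measurableSet_Ioc] with u hu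
    exact entireExpInt_nonneg (div_pos hlam hu.1)
  have h2 : ∫ u in (0 : ℝ)..lam, entireExpInt (lam / u) ≤ 4 * lam := by
    have : ∫ u in (0 : ℝ)..lam, entireExpInt (lam / u) ≤
        ∫ u in (0 : ℝ)..lam, 2 * lam ^ (1 / 2 : ℝ) * u ^ (-(1 / 2) : ℝ) := by
      refine intervalIntegral.integral_mono_on_of_le_Ioo hlam.le hi1
        ((intervalIntegral.intervalIntegrable_rpow' (by norm_num)).const_mul _) fun u hu => ?_
      exact entireExpInt_div_le hlam hu.1
    refine this.trans_eq ?_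
    rw [intervalIntegral.integral_const_mul, integral_rpow (Or.inl (by norm_num))]
    norm_num
    have h3 : lam ^ (1 / 2 : ℝ) * lam ^ (1 / 2 : ℝ) = lam := by
      rw [← Real.rpow_add hlam]; norm_num
    norm_num at h3
    linear_combination 4 * h3
  have h3 : ∫ u in lam..M, entireExpInt (lam / u) ≤ lam * Real.log (M / lam) := by
    rw [← integral_inv_of_pos hlam hM, ← intervalIntegral.integral_const_mul]
    refine intervalIntegral.integral_mono_on hlM hi2 ?_ fun u hu => ?_
    · refine (continuousOn_inv₀.mono fun y hy => ?_).intervalIntegrable.const_mul _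
      rw [uIcc_of_le hlM] at hy
      exact (hlam.trans_le hy.1).ne'
    · exact entireExpInt_le_self (div_pos hlam (hlam.trans_le hu.1))
  have h4 : Real.log (M / lam) = logPlus (X / lam) := by
    rw [logPlus]
    rcases le_total X lam with h | h
    · rw [hMdef, max_eq_right h, div_self hlam.ne', Real.log_one, max_eq_right]
      exact Real.log_nonpos (by positivity) ((div_le_one hlam).2 h)
    · rw [hMdef, max_eq_left h, max_eq_left]
      exact Real.log_nonneg ((one_le_div hlam).2 h)
  have h5 := intervalIntegral.integral_add_adjacent_intervals hi1 hi2
  rw [← h4]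
  linarith

theorem mul_volterraDeriv_le {w L : ℝ} (hw : 0 < w) (hwL : w ≤ L) :
    w * volterraDeriv w ≤ L * volterraDeriv L := by
  have hL := hw.trans_le hwL
  rw [volterraDeriv_eq, volterraDeriv_eq, ← integral_const_mul, ← integral_const_mul]
  refine setIntegral_mono_on ((integrableOn_rpow_mul_inv_Gamma hw).const_mul _)
    ((integrableOn_rpow_mul_inv_Gamma hL).const_mul _) measurableSet_Ioi fun s hs => ?_
  have hs : 0 < s := hs
  have hΓ := Real.Gamma_pos_of_pos hs
  rw [← mul_assoc, ← mul_assoc, Real.rpow_sub_one hw.ne', Real.rpow_sub_one hL.ne',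
    mul_div_cancel₀ _ hw.ne', mul_div_cancel₀ _ hL.ne']
  gcongr

theorem volterra_le_volterra {w L : ℝ} (hw : 0 < w) (hwL : w ≤ L) :
    volterra w ≤ volterra L := by
  have hL := hw.trans_le hwL
  have h01 := Ioi_subset_Ioi (zero_le_one (α := ℝ))
  rw [volterra_eq, volterra_eq]
  refine setIntegral_mono_on ((integrableOn_rpow_mul_inv_Gamma hw).mono_set h01)
    ((integrableOn_rpow_mul_inv_Gamma hL).mono_set h01) measurableSet_Ioi fun s hs => ?_
  have hs : 1 < s := hs
  have hΓ := Real.Gamma_pos_of_pos (zero_lt_one.trans hs)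
  have : 0 ≤ s - 1 := by linarith
  gcongr

theorem volterra_nonneg {w : ℝ} (hw : 0 ≤ w) : 0 ≤ volterra w := by
  rw [volterra_eq]
  refine setIntegral_nonneg measurableSet_Ioi fun s hs => ?_
  have := Real.Gamma_pos_of_pos (zero_lt_one.trans hs)
  positivity

theorem integrableOn_entireExpInt_mul_volterraDeriv {X lam : ℝ} (hX : 0 < X) (hlam : 0 < lam) :
    IntegrableOn (fun w => entireExpInt (lam / (X - w)) * volterraDeriv w) (Ioo 0 X) := by
  have h := (integrableOn_rpow_mul_volterraDeriv hX (a := 1 / 2) (by norm_num)).const_mul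
    (2 * lam ^ (1 / 2 : ℝ))
  refine Integrable.mono' h ((aestronglyMeasurable_entireExpInt_div_sub hlam).mul
    (integrableOn_volterraDeriv hX).aestronglyMeasurable) ?_
  filter_upwards [ae_restrict_mem measurableSet_Ioo] with w hw
  have h0 := volterraDeriv_nonneg hw.1.le
  have h1 := sub_pos.2 hw.2
  rw [norm_mul, Real.norm_of_nonneg h0, Real.norm_of_nonneg (entireExpInt_nonneg (div_pos hlam h1)),
    ← mul_assoc]
  gcongr
  convert! entireExpInt_div_le hlam h1 using 3
  norm_num

theorem expInt_volterraDeriv_convolution_eq {x lam : ℝ} (hx : 0 < x) (hlam : 0 < lam) :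
    lam * (∫ y in (0 : ℝ)..x, expInt (1 / (x - y)) * volterraDeriv (lam * y))
        + 1 + (Real.log lam + 2 * eulerGamma) * volterra (x * lam) =
      ∫ w in Ioo 0 (lam * x), entireExpInt (lam / (lam * x - w)) * volterraDeriv w := by
  have hX : 0 < lam * x := by positivity
  set X := lam * x with hXdef
  have h1 : lam * (∫ y in (0 : ℝ)..x, expInt (1 / (x - y)) * volterraDeriv (lam * y)) =
      ∫ w in Ioo 0 X, expInt (lam / (X - w)) * volterraDeriv w := by
    have := intervalIntegral.mul_integral_comp_mul_left (a := 0) (b := x)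
      (f := fun w => expInt (lam / (X - w)) * volterraDeriv w) lam
    rw [mul_zero, intervalIntegral.integral_of_le (b := lam * x) hX.le,
      integral_Ioc_eq_integral_Ioo] at this
    rw [← this]
    congr 2 with y
    rw [hXdef, ← mul_sub]
    congr 2
    rw [← div_div, div_self hlam.ne']
  obtain ⟨hlogi, hlog⟩ := log_convolution_volterraDeriv hX
  have hE := integrableOn_entireExpInt_mul_volterraDeriv hX hlam
  have hν := (integrableOn_volterraDeriv hX).const_mul (Real.log lam + eulerGamma)
  have h2 : ∫ w in Ioo 0 X, expInt (lam / (X - w)) * volterraDeriv w =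
      ∫ w in Ioo 0 X, (entireExpInt (lam / (X - w)) * volterraDeriv w +
        Real.log (X - w) * volterraDeriv w) - (Real.log lam + eulerGamma) * volterraDeriv w := by
    refine setIntegral_congr_fun measurableSet_Ioo fun w hw => ?_
    have hu := sub_pos.2 hw.2
    simp only [entireExpInt]
    rw [Real.log_div hlam.ne' hu.ne']
    ring
  have hsub := integral_sub (hE.add hlogi) hν
  simp only [Pi.add_apply] at hsub
  rw [h1, h2, hsub, integral_add hE hlogi, hlog, integral_const_mul,
    integral_volterraDeriv hX, mul_comm x lam]
  ring

theorem integral_entireExpInt_mul_volterraDeriv_le {L x lam : ℝ} (hx : 0 < x)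
    (hlam : 0 < lam) (hl : 1 / L < lam * x) (hu : lam * x < L) :
    ∫ w in Ioo 0 (lam * x), entireExpInt (lam / (lam * x - w)) * volterraDeriv w ≤
      (2 * volterra L + 8 * L ^ 3 * volterraDeriv L) * (1 + logPlus x) / x := by
  have hX : 0 < lam * x := by positivity
  set X := lam * x with hXdef
  have hL : 0 < L := hX.trans hu
  set M := 2 * L ^ 2 * volterraDeriv L with hMdef
  have hVL := volterraDeriv_nonneg hL.le
  have hM : 0 ≤ M := by positivity
  have hν := (integrableOn_volterraDeriv hX).const_mul (2 / x)
  have hE : IntegrableOn (fun w => entireExpInt (lam / (X - w))) (Ioo 0 X) := by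
    have := (intervalIntegrable_entireExpInt_div hlam hX).comp_sub_left X
    rw [sub_zero, sub_self] at this
    have := this.symm
    rw [intervalIntegrable_iff_integrableOn_Ioc_of_le hX.le] at this
    exact this.mono_set Ioo_subset_Ioc_self
  have h1 : ∫ w in Ioo 0 X, entireExpInt (lam / (X - w)) * volterraDeriv w ≤
      ∫ w in Ioo 0 X, (2 / x * volterraDeriv w + M * entireExpInt (lam / (X - w))) := by
    refine setIntegral_mono_on (integrableOn_entireExpInt_mul_volterraDeriv hX hlam)
      (hν.add (hE.const_mul M)) measurableSet_Ioo fun w hw => ?_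
    have hw0 : 0 < w := hw.1
    have hXw := sub_pos.2 hw.2
    have h0 := volterraDeriv_nonneg hw.1.le
    have hE0 := entireExpInt_nonneg (div_pos hlam hXw)
    rcases le_total w (X / 2) with h | h
    · have h3 : entireExpInt (lam / (X - w)) ≤ 2 / x := by
        refine (entireExpInt_le_self (div_pos hlam hXw)).trans ?_
        rw [div_le_div_iff₀ hXw hx]
        linarith
      have h4 := mul_le_mul_of_nonneg_right h3 h0
      have h5 := mul_nonneg hM hE0
      linarith
    · have h3 : volterraDeriv w ≤ M := by
        have h4 := mul_volterraDeriv_le hw0 (hw.2.le.trans hu.le)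
        have h5 : 1 ≤ 2 * L * w := by
          have := (div_lt_iff₀ hL).1 hl
          nlinarith
        calc volterraDeriv w ≤ (2 * L * w) * volterraDeriv w := le_mul_of_one_le_left h0 h5
          _ = 2 * L * (w * volterraDeriv w) := by ring
          _ ≤ 2 * L * (L * volterraDeriv L) := by gcongr
          _ = M := by rw [hMdef]; ring
      have h4 := mul_le_mul_of_nonneg_left h3 hE0
      have h5 : 0 ≤ 2 / x * volterraDeriv w := by positivity
      linarith
  have h2 : ∫ w in Ioo 0 X, entireExpInt (lam / (X - w)) ≤ lam * (4 + logPlus x) := by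
    have h3 := integral_entireExpInt_div_le hlam hX
    have h4 := intervalIntegral.integral_comp_sub_left (a := 0) (b := X)
      (fun u => entireExpInt (lam / u)) X
    rw [sub_zero, sub_self, intervalIntegral.integral_of_le hX.le,
      integral_Ioc_eq_integral_Ioo] at h4
    rwa [h4, show x = X / lam by rw [hXdef]; field_simp]
  rw [integral_add hν (hE.const_mul M), integral_const_mul, integral_const_mul,
    integral_volterraDeriv hX] at h1
  have hp : 0 ≤ logPlus x := le_max_right _ _
  have hlL : lam ≤ L / x := by
    rw [le_div_iff₀ hx]
    exact hu.le
  have hvL := volterra_nonneg hL.le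
  calc _ ≤ 2 / x * volterra X + M * ∫ w in Ioo 0 X, entireExpInt (lam / (X - w)) := h1
    _ ≤ 2 / x * (volterra L * (1 + logPlus x)) + M * (L / x * (4 * (1 + logPlus x))) := by
        have h3 : volterra X ≤ volterra L * (1 + logPlus x) :=
          (volterra_le_volterra hX hu.le).trans (le_mul_of_one_le_right hvL (by linarith))
        have h4 : ∫ w in Ioo 0 X, entireExpInt (lam / (X - w)) ≤
            L / x * (4 * (1 + logPlus x)) := by
          refine h2.trans ?_
          gcongr
          linarith
        gcongr
    _ = _ := by rw [hMdef]; ring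

/-- For every `L > 1` there is `C_L > 0` such that for all `x, λ > 0` with `1/L < λx < L`:
`|λ ∫₀^x E(1/(x−y)) ν′(λ y) dy + 1 + (log λ + 2γ_EM) ν(xλ)| ≤ C_L (1 + log⁺ x)/x`. -/
theorem expInt_volterraDeriv_convolution_approx (L : ℝ) (hL : 1 < L) :
    ∃ C > 0, ∀ x lam : ℝ, 0 < x → 0 < lam → 1 / L < lam * x → lam * x < L →
      |lam * (∫ y in (0 : ℝ)..x, expInt (1 / (x - y)) * volterraDeriv (lam * y))
          + 1 + (Real.log lam + 2 * eulerGamma) * volterra (x * lam)|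
        ≤ C * (1 + logPlus x) / x := by
  have hL0 : 0 < L := zero_lt_one.trans hL
  have hvL := volterra_nonneg hL0.le
  have hVL := volterraDeriv_nonneg hL0.le
  refine ⟨2 * volterra L + 8 * L ^ 3 * volterraDeriv L + 1, by positivity,
    fun x lam hx hlam hl hu => ?_⟩
  have hp : 0 ≤ logPlus x := le_max_right _ _
  rw [expInt_volterraDeriv_convolution_eq hx hlam, abs_of_nonneg]
  · refine (integral_entireExpInt_mul_volterraDeriv_le hx hlam hl hu).trans ?_
    gcongr ?_ * _ / _
    linarith
  · refine setIntegral_nonneg measurableSet_Ioo fun w hw => ?_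
    exact mul_nonneg (entireExpInt_nonneg (div_pos hlam (sub_pos.2 hw.2)))
      (volterraDeriv_nonneg hw.1.le)
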